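/- Let α ∈ [0,1] and let φ : ℝ → ℝ be bounded and continuous. Then for every x ∈ ℝ, Q_t φ(x) → φ(x) as t → 0+ (strong continuity of the Skew Brownian motion semigroup at time 0). -/

import Mathlib

open MeasureTheory Real Filter

/-- The Gaussian heat kernel `p(t,x,y) = (2πt)^{-1/2} exp(-(x-y)²/(2t))`. -/
noncomputable def heatKernel (t x y : ℝ) : ℝ :=
  (Real.sqrt (2 * Real.pi * t))⁻¹ * Real.exp (-(x - y) ^ 2 / (2 * t))

/-- The transition kernel of the Skew Brownian motion of parameter `α`:
`q_α(t,x,y) = p(t,x,y) + (2α-1)·sgn(y)·(2πt)^{-1/2} exp(-(|x|+|y|)²/(2t))`. -/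
noncomputable def skewKernel (α t x y : ℝ) : ℝ :=
  heatKernel t x y +
    (2 * α - 1) * Real.sign y * (Real.sqrt (2 * Real.pi * t))⁻¹ *
      Real.exp (-(|x| + |y|) ^ 2 / (2 * t))

/-- The Skew Brownian motion semigroup applied to a function:
`Q_t φ(x) = ∫ q_α(t,x,y) φ(y) dy`. -/
noncomputable def skewSemigroup (α t : ℝ) (φ : ℝ → ℝ) (x : ℝ) : ℝ :=
  ∫ y, skewKernel α t x y * φ y

theorem Real.measurable_sign : Measurable Real.sign :=
  Measurable.ite measurableSet_Iio measurable_const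
    (Measurable.ite measurableSet_Ioi measurable_const measurable_const)

theorem Real.abs_sign_le_one (r : ℝ) : |Real.sign r| ≤ 1 := by
  rcases Real.sign_apply_eq r with h | h | h <;> simp [h]

theorem Real.sign_pos_mul {s : ℝ} (hs : 0 < s) (r : ℝ) : Real.sign (s * r) = Real.sign r := by
  rcases lt_trichotomy r 0 with h | rfl | h
  · rw [Real.sign_of_neg h, Real.sign_of_neg (mul_neg_of_pos_of_neg hs h)]
  · simp
  · rw [Real.sign_of_pos h, Real.sign_of_pos (mul_pos hs h)]

theorem integral_sign_mul_exp_neg_mul_sq (b : ℝ) :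
    ∫ z : ℝ, Real.sign z * exp (-b * z ^ 2) = 0 := by
  have h := integral_neg_eq_self (fun z : ℝ => Real.sign z * exp (-b * z ^ 2)) volume
  simp only [Real.sign_neg, neg_sq, neg_mul, integral_neg] at h ⊢
  linarith

theorem integrable_sign_mul_exp_neg_mul_sq {b : ℝ} (hb : 0 < b) :
    Integrable fun z : ℝ => Real.sign z * exp (-b * z ^ 2) :=
  (integrable_exp_neg_mul_sq hb).bdd_mul (c := 1) Real.measurable_sign.aestronglyMeasurable
    (ae_of_all _ Real.abs_sign_le_one)

/-- Parabolic rescaling `y = x + s z` of the skew semigroup at time `s ^ 2`. -/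
theorem skewSemigroup_sq_eq_integral (α : ℝ) (φ : ℝ → ℝ) (x : ℝ) {s : ℝ} (hs : 0 < s) :
    skewSemigroup α (s ^ 2) φ x =
      ∫ z, (√(2 * π))⁻¹ * (exp (-(1 / 2) * z ^ 2) +
        (2 * α - 1) * (Real.sign (x + s * z) *
          exp (-(|x| + |x + s * z|) ^ 2 / (2 * s ^ 2)))) * φ (x + s * z) := by
  have h₁ := integral_add_left_eq_self (μ := volume)
    (fun y => skewKernel α (s ^ 2) x y * φ y) x
  have h₂ := Measure.integral_comp_mul_left
    (fun y => skewKernel α (s ^ 2) x (x + y) * φ (x + y)) s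
  rw [h₁, abs_of_pos (inv_pos.2 hs), smul_eq_mul] at h₂
  have h₃ : skewSemigroup α (s ^ 2) φ x =
      s * ∫ z, skewKernel α (s ^ 2) x (x + s * z) * φ (x + s * z) := by
    rw [h₂, mul_inv_cancel_left₀ hs.ne', skewSemigroup]
  rw [h₃, ← integral_const_mul]
  congr 1 with z
  have hsqrt : √(2 * π * s ^ 2) = √(2 * π) * s := by
    rw [Real.sqrt_mul (by positivity), Real.sqrt_sq hs.le]
  have hexp : -(x - (x + s * z)) ^ 2 / (2 * s ^ 2) = -(1 / 2) * z ^ 2 := by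
    field_simp
    ring
  rw [skewKernel, heatKernel, hsqrt, hexp]
  field_simp

theorem neg_abs_add_abs_sq_div_le (x z : ℝ) {s : ℝ} (hs : 0 < s) :
    -(|x| + |x + s * z|) ^ 2 / (2 * s ^ 2) ≤ -(1 / 2) * z ^ 2 := by
  have hle : |s * z| ≤ |x| + |x + s * z| := by
    have := abs_sub (x + s * z) x
    rw [add_sub_cancel_left] at this
    linarith
  have hsq : (s * z) ^ 2 ≤ (|x| + |x + s * z|) ^ 2 := by
    rw [← sq_abs (s * z)]
    gcongr
  rw [div_le_iff₀ (by positivity)]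
  linarith

theorem tendsto_exp_neg_div_sq_nhdsGT_zero {c : ℝ} (hc : 0 < c) :
    Tendsto (fun s : ℝ => exp (-(c / s ^ 2))) (nhdsWithin 0 (Set.Ioi 0)) (nhds 0) := by
  refine tendsto_exp_neg_atTop_nhds_zero.comp ?_
  have h : Tendsto (fun s : ℝ => c * (s⁻¹) ^ 2) (nhdsWithin 0 (Set.Ioi 0)) atTop :=
    ((tendsto_pow_atTop two_ne_zero).comp tendsto_inv_nhdsGT_zero).const_mul_atTop hc
  simpa [div_eq_mul_inv] using h

/-- As `s → 0+`, the rescaled reflection term vanishes for `x ≠ 0` and is constant for `x = 0`. -/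
theorem tendsto_sign_mul_exp_neg_abs_add_abs (x z : ℝ) :
    Tendsto (fun s : ℝ => Real.sign (x + s * z) *
        exp (-(|x| + |x + s * z|) ^ 2 / (2 * s ^ 2)))
      (nhdsWithin 0 (Set.Ioi 0))
      (nhds ((if x = 0 then 1 else 0) * (Real.sign z * exp (-(1 / 2) * z ^ 2)))) := by
  split_ifs with hx
  · subst hx
    refine tendsto_const_nhds.congr' ?_
    filter_upwards [self_mem_nhdsWithin] with s hs
    have hs : 0 < s := hs
    rw [zero_add, Real.sign_pos_mul hs, abs_zero, zero_add, sq_abs, one_mul]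
    congr 2
    field_simp
  · rw [zero_mul]
    refine squeeze_zero_norm' ?_
      (tendsto_exp_neg_div_sq_nhdsGT_zero (c := x ^ 2 / 2) (by positivity))
    filter_upwards [self_mem_nhdsWithin] with s hs
    have hs : 0 < s := hs
    rw [norm_mul, Real.norm_eq_abs, Real.norm_eq_abs, abs_exp]
    refine (mul_le_of_le_one_left (exp_pos _).le (Real.abs_sign_le_one _)).trans ?_
    rw [exp_le_exp, neg_div, neg_le_neg_iff, div_div, ← sq_abs x]
    gcongr
    exact le_add_of_nonneg_right (abs_nonneg _)

theorem tendsto_skewSemigroup_sq {α : ℝ} (hα : α ∈ Set.Icc (0 : ℝ) 1)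
    {φ : ℝ → ℝ} (hφc : Continuous φ) (hφb : ∃ M, ∀ x, |φ x| ≤ M) (x : ℝ) :
    Tendsto (fun s => skewSemigroup α (s ^ 2) φ x) (nhdsWithin 0 (Set.Ioi 0)) (nhds (φ x)) := by
  obtain ⟨M, hM⟩ := hφb
  have hα' : |2 * α - 1| ≤ 1 := abs_le.2 ⟨by linarith [hα.1], by linarith [hα.2]⟩
  have hgauss : Integrable fun z : ℝ => exp (-(1 / 2) * z ^ 2) :=
    integrable_exp_neg_mul_sq (by norm_num)
  have hlim : ∫ z : ℝ, (√(2 * π))⁻¹ * (exp (-(1 / 2) * z ^ 2) + (2 * α - 1) *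
      ((if x = 0 then 1 else 0) * (Real.sign z * exp (-(1 / 2) * z ^ 2)))) * φ x = φ x := by
    have hodd : Integrable fun z : ℝ => Real.sign z * exp (-(1 / 2) * z ^ 2) :=
      integrable_sign_mul_exp_neg_mul_sq (by norm_num)
    rw [integral_mul_const, integral_const_mul,
      integral_add hgauss ((hodd.const_mul _).const_mul _), integral_const_mul,
      integral_const_mul, integral_sign_mul_exp_neg_mul_sq, integral_gaussian, mul_zero,
      mul_zero, add_zero, show π / (1 / 2) = 2 * π by ring,
      inv_mul_cancel₀ (by positivity), one_mul]
  have hshift (z : ℝ) : Tendsto (fun s : ℝ => φ (x + s * z))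
      (nhdsWithin 0 (Set.Ioi 0)) (nhds (φ x)) := by
    have h : Continuous fun s : ℝ => φ (x + s * z) := by fun_prop
    simpa using (h.tendsto 0).mono_left nhdsWithin_le_nhds
  refine Tendsto.congr' (eventually_nhdsWithin_of_forall fun s hs =>
    (skewSemigroup_sq_eq_integral α φ x hs).symm) ?_
  rw [← hlim]
  refine tendsto_integral_filter_of_dominated_convergence
    (fun z => (√(2 * π))⁻¹ * (exp (-(1 / 2) * z ^ 2) + exp (-(1 / 2) * z ^ 2)) * M)
    (Eventually.of_forall fun s => ?_)
    (eventually_nhdsWithin_of_forall fun s hs => ae_of_all _ fun z => ?_)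
    (((hgauss.add hgauss).const_mul _).mul_const _)
    (ae_of_all _ fun z => ?_)
  · have hsign : Measurable fun z : ℝ => Real.sign (x + s * z) :=
      Real.measurable_sign.comp (by fun_prop)
    have hφm := hφc.measurable
    exact Measurable.aestronglyMeasurable (by fun_prop)
  · rw [norm_mul, norm_mul, Real.norm_of_nonneg (by positivity : 0 ≤ (√(2 * π))⁻¹)]
    gcongr
    · refine (norm_add_le _ _).trans ?_
      rw [norm_mul, norm_mul, Real.norm_eq_abs, Real.norm_eq_abs, Real.norm_eq_abs,
        Real.norm_eq_abs, abs_exp, abs_exp]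
      gcongr
      calc |2 * α - 1| * (|Real.sign (x + s * z)| *
            exp (-(|x| + |x + s * z|) ^ 2 / (2 * s ^ 2)))
          ≤ 1 * (1 * exp (-(1 / 2) * z ^ 2)) := by
            gcongr
            · exact Real.abs_sign_le_one _
            · exact neg_abs_add_abs_sq_div_le x z hs
        _ = exp (-(1 / 2) * z ^ 2) := by ring
    · exact hM _
  · exact ((((tendsto_sign_mul_exp_neg_abs_add_abs x z).const_mul _).const_add _).const_mul _).mul
      (hshift z)

theorem skewSemigroup_strong_continuity (α : ℝ) (hα : α ∈ Set.Icc (0 : ℝ) 1)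
    (φ : ℝ → ℝ) (hφc : Continuous φ) (hφb : ∃ M, ∀ x, |φ x| ≤ M) (x : ℝ) :
    Tendsto (fun t => skewSemigroup α t φ x) (nhdsWithin 0 (Set.Ioi 0)) (nhds (φ x)) := by
  have hsqrt : Tendsto Real.sqrt (nhdsWithin 0 (Set.Ioi 0)) (nhdsWithin 0 (Set.Ioi 0)) := by
    refine tendsto_nhdsWithin_of_tendsto_nhds_of_eventually_within _ ?_
      (eventually_nhdsWithin_of_forall fun t ht => Real.sqrt_pos.2 ht)
    simpa using (Real.continuous_sqrt.tendsto 0).mono_left nhdsWithin_le_nhds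
  refine ((tendsto_skewSemigroup_sq hα hφc hφb x).comp hsqrt).congr'
    (eventually_nhdsWithin_of_forall fun t ht => ?_)
  rw [Function.comp_apply, Real.sq_sqrt (le_of_lt ht)]
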